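/- Suppose N ≥ 2 is an integer, δ, μ > 0 satisfy condition (H₁), 2 ≤ p < N and 2 ≤ q < N, and 1/(δ+1) + 1/(μ+1) > (N(M−1) − M)/(N(M−1)) where M = max{p,q}. Then there exists no radial ground state: there is no pair (u,v) of real functions on [0,∞), continuously differentiable on [0,∞) and twice continuously differentiable on (0,∞), with u(r) > 0 and v(r) > 0 for all r ≥ 0, u'(0) = v'(0) = 0, satisfying for all r > 0: (r^{N−1}|u'(r)|^{p−2}u'(r))' = −r^{N−1} v(r)^δ and (r^{N−1}|v'(r)|^{q−2}v'(r))' = −r^{N−1} u(r)^μ. -/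

import Mathlib

/-- A radial ground state of system (S_∞) on `[0,∞)`. -/
def IsGroundState (N : ℕ) (p q δ μ : ℝ) (u v : ℝ → ℝ) : Prop :=
  ContDiffOn ℝ 1 u (Set.Ici 0) ∧ ContDiffOn ℝ 1 v (Set.Ici 0) ∧
  ContDiffOn ℝ 2 u (Set.Ioi 0) ∧ ContDiffOn ℝ 2 v (Set.Ioi 0) ∧
  (∀ r : ℝ, 0 ≤ r → 0 < u r) ∧ (∀ r : ℝ, 0 ≤ r → 0 < v r) ∧
  deriv u 0 = 0 ∧ deriv v 0 = 0 ∧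
  (∀ r : ℝ, 0 < r →
    deriv (fun s => s ^ ((N:ℝ) - 1) * |deriv u s| ^ (p - 2) * deriv u s) r
      = -(r ^ ((N:ℝ) - 1) * v r ^ δ)) ∧
  (∀ r : ℝ, 0 < r →
    deriv (fun s => s ^ ((N:ℝ) - 1) * |deriv v s| ^ (q - 2) * deriv v s) r
      = -(r ^ ((N:ℝ) - 1) * u r ^ μ))

open Filter Topology Set

/-- A function on `(0,∞)` that vanishes at the origin and has nonnegative derivative is
nonnegative. -/
lemma nonneg_of_hasDerivAt_of_tendsto_zero {f f' : ℝ → ℝ}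
    (hf : ∀ r, 0 < r → HasDerivAt f (f' r) r) (hf' : ∀ r, 0 < r → 0 ≤ f' r)
    (h0 : Tendsto f (𝓝[>] 0) (𝓝 0)) {r : ℝ} (hr : 0 < r) : 0 ≤ f r := by
  have hmono : MonotoneOn f (Ioi 0) := by
    refine monotoneOn_of_hasDerivWithinAt_nonneg (f' := f') (convex_Ioi 0)
      (fun x hx => (hf x hx).continuousAt.continuousWithinAt) ?_ ?_
    · intro x hx
      rw [interior_Ioi] at hx
      exact (hf x hx).hasDerivWithinAt
    · intro x hx
      rw [interior_Ioi] at hx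
      exact hf' x hx
  refine le_of_tendsto h0 ?_
  filter_upwards [Ioo_mem_nhdsGT hr] with s hs
  exact hmono hs.1 hr hs.2.le

/-- A function on `(0,∞)` that vanishes at the origin and has positive derivative is positive and
strictly increasing. -/
lemma pos_and_strictMonoOn_of_hasDerivAt_of_tendsto_zero {f f' : ℝ → ℝ}
    (hf : ∀ r, 0 < r → HasDerivAt f (f' r) r) (hf' : ∀ r, 0 < r → 0 < f' r)
    (h0 : Tendsto f (𝓝[>] 0) (𝓝 0)) :
    (∀ r, 0 < r → 0 < f r) ∧ StrictMonoOn f (Ioi 0) := by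
  have hmono : StrictMonoOn f (Ioi 0) := by
    refine strictMonoOn_of_hasDerivWithinAt_pos (f' := f') (convex_Ioi 0)
      (fun x hx => (hf x hx).continuousAt.continuousWithinAt) ?_ ?_
    · intro x hx
      rw [interior_Ioi] at hx
      exact (hf x hx).hasDerivWithinAt
    · intro x hx
      rw [interior_Ioi] at hx
      exact hf' x hx
  refine ⟨fun r hr => ?_, hmono⟩
  have h1 := nonneg_of_hasDerivAt_of_tendsto_zero hf (fun x hx => (hf' x hx).le) h0 (half_pos hr)
  exact h1.trans_lt (hmono (half_pos hr) hr (half_lt_self hr))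

/-- One equation of the radial system in terms of `U = -u'`: on `(0,∞)` the function `u` is
positive and decreasing and `(r ^ (n - 1) U ^ (p - 1))' = r ^ (n - 1) v ^ δ`. -/
structure IsRadialComponent (n p δ : ℝ) (u v U : ℝ → ℝ) : Prop where
  pos : ∀ r, 0 < r → 0 < u r
  slope_pos : ∀ r, 0 < r → 0 < U r
  hasDerivAt : ∀ r, 0 < r → HasDerivAt u (-U r) r
  hasDerivAt_flux : ∀ r, 0 < r →
    HasDerivAt (fun s => s ^ (n - 1) * U s ^ (p - 1)) (r ^ (n - 1) * v r ^ δ) r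
  differentiableAt : ∀ r, 0 < r → DifferentiableAt ℝ U r
  tendsto : ∃ c, 0 < c ∧ Tendsto u (𝓝[>] 0) (𝓝 c)
  tendsto_slope : ∃ c, Tendsto U (𝓝[>] 0) (𝓝 c)

lemma isRadialComponent_of_contDiffOn {n p δ : ℝ} {u v : ℝ → ℝ} (hn : 2 ≤ n) (hp : 2 ≤ p)
    (h1 : ContDiffOn ℝ 1 u (Ici 0)) (h2 : ContDiffOn ℝ 2 u (Ioi 0))
    (hu : ∀ r, 0 ≤ r → 0 < u r) (hv : ∀ r, 0 ≤ r → 0 < v r)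
    (heq : ∀ r, 0 < r → deriv (fun s => s ^ (n - 1) * |deriv u s| ^ (p - 2) * deriv u s) r
      = -(r ^ (n - 1) * v r ^ δ)) :
    IsRadialComponent n p δ u v (fun r => -deriv u r) := by
  have hrhs : ∀ r : ℝ, 0 < r → 0 < r ^ (n - 1) * v r ^ δ := fun r hr =>
    mul_pos (Real.rpow_pos_of_pos hr _) (Real.rpow_pos_of_pos (hv r hr.le) _)
  have hder : ∀ r, 0 < r → HasDerivAt (fun s => -(s ^ (n - 1) * |deriv u s| ^ (p - 2) * deriv u s))
      (r ^ (n - 1) * v r ^ δ) r := by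
    intro r hr
    have hd : DifferentiableAt ℝ (fun s => s ^ (n - 1) * |deriv u s| ^ (p - 2) * deriv u s) r := by
      refine differentiableAt_of_deriv_ne_zero ?_
      rw [heq r hr]
      exact neg_ne_zero.2 (hrhs r hr).ne'
    have := hd.hasDerivAt.neg
    rw [heq r hr, neg_neg] at this
    exact this
  obtain ⟨c, hc⟩ : ∃ c, Tendsto (deriv u) (𝓝[>] 0) (𝓝 c) := by
    refine ⟨derivWithin u (Ici 0) 0, ?_⟩
    have hcont := (h1.continuousOn_derivWithin (uniqueDiffOn_Ici 0) le_rfl) 0 self_mem_Ici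
    refine (hcont.mono_left (nhdsWithin_mono _ Ioi_subset_Ici_self)).congr' ?_
    filter_upwards [self_mem_nhdsWithin] with r hr
    exact derivWithin_of_mem_nhds (Ici_mem_nhds hr)
  have hlim : Tendsto (fun s => -(s ^ (n - 1) * |deriv u s| ^ (p - 2) * deriv u s)) (𝓝[>] 0)
      (𝓝 0) := by
    have hs : Tendsto (fun s : ℝ => s ^ (n - 1)) (𝓝[>] 0) (𝓝 0) := by
      have : Tendsto (fun s : ℝ => s ^ (n - 1)) (𝓝[>] 0) (𝓝 (0 ^ (n - 1))) :=
        (tendsto_nhdsWithin_of_tendsto_nhds tendsto_id).rpow_const (Or.inr (by linarith))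
      rwa [Real.zero_rpow (by linarith)] at this
    have := ((hs.mul (hc.abs.rpow_const (p := p - 2) (Or.inr (by linarith)))).mul hc).neg
    simpa using this
  have hneg : ∀ r, 0 < r → deriv u r < 0 := by
    intro r hr
    have hpos := (pos_and_strictMonoOn_of_hasDerivAt_of_tendsto_zero hder hrhs hlim).1 r hr
    by_contra! hge
    have : 0 ≤ r ^ (n - 1) * |deriv u r| ^ (p - 2) * deriv u r := by positivity
    linarith
  have hCD : ∀ r, 0 < r → ContDiffAt ℝ 2 u r := fun r hr => h2.contDiffAt (Ioi_mem_nhds hr)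
  refine ⟨fun r hr => hu r hr.le, fun r hr => neg_pos.2 (hneg r hr), fun r hr => ?_,
    fun r hr => ?_, fun r hr => ?_, ⟨u 0, hu 0 le_rfl, ?_⟩, ⟨-c, hc.neg⟩⟩
  · rw [neg_neg]
    exact ((hCD r hr).differentiableAt (by norm_num)).hasDerivAt
  · refine (hder r hr).congr_of_eventuallyEq ?_
    filter_upwards [Ioi_mem_nhds hr] with s hs
    have hs' := neg_pos.2 (hneg s hs)
    rw [abs_of_neg (hneg s hs), show p - 1 = (p - 2) + 1 by ring, Real.rpow_add_one hs'.ne']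
    ring
  · have h21 : ContDiffAt ℝ 1 (deriv u) r := (hCD r hr).derivWithin (by norm_num)
    exact (h21.differentiableAt (by norm_num)).neg
  · exact (h1.continuousOn 0 self_mem_Ici).mono_left (nhdsWithin_mono _ Ioi_subset_Ici_self)

namespace IsRadialComponent

variable {n p q δ μ : ℝ} {u v U V : ℝ → ℝ}

lemma mul_rpow_le_slope (h : IsRadialComponent n p δ u v U) (h' : IsRadialComponent n q μ v u V)
    (hn : 2 ≤ n) (hp : 2 ≤ p) (hδ : 0 < δ) {r : ℝ} (hr : 0 < r) :
    r * v r ^ δ ≤ n * U r ^ (p - 1) := by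
  have hder : ∀ s, 0 < s → HasDerivAt
      (fun s => n * (s ^ (n - 1) * U s ^ (p - 1)) - s ^ n * v s ^ δ)
      (δ * s ^ n * v s ^ (δ - 1) * V s) s := by
    intro s hs
    have h1 := (h.hasDerivAt_flux s hs).const_mul n
    have h2 := ((hasDerivAt_id s).rpow_const (p := n) (Or.inl hs.ne')).mul
      ((h'.hasDerivAt s hs).rpow_const (p := δ) (Or.inl (h'.pos s hs).ne'))
    refine (h1.sub h2).congr_deriv ?_
    simp only [id]
    ring
  have hlim : Tendsto (fun s => n * (s ^ (n - 1) * U s ^ (p - 1)) - s ^ n * v s ^ δ)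
      (𝓝[>] 0) (𝓝 0) := by
    have hid : Tendsto (fun s : ℝ => s) (𝓝[>] 0) (𝓝 0) :=
      tendsto_nhdsWithin_of_tendsto_nhds tendsto_id
    obtain ⟨c, hc⟩ := h.tendsto_slope
    obtain ⟨d, _, hd⟩ := h'.tendsto
    have := (((hid.rpow_const (p := n - 1) (Or.inr (by linarith))).mul
      (hc.rpow_const (p := p - 1) (Or.inr (by linarith)))).const_mul n).sub
      ((hid.rpow_const (p := n) (Or.inr (by linarith))).mul
      (hd.rpow_const (p := δ) (Or.inr hδ.le)))
    rw [Real.zero_rpow (by linarith), Real.zero_rpow (by linarith)] at this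
    simpa using this
  have h0 := nonneg_of_hasDerivAt_of_tendsto_zero hder (fun s hs => by
    have := h'.pos s hs
    have := h'.slope_pos s hs
    positivity) hlim hr
  have hrn : r ^ n = r ^ (n - 1) * r := by
    rw [← Real.rpow_add_one hr.ne', sub_add_cancel]
  have hpos : 0 < r ^ (n - 1) := Real.rpow_pos_of_pos hr _
  rw [hrn] at h0
  have : 0 ≤ r ^ (n - 1) * (n * U r ^ (p - 1) - r * v r ^ δ) := by linarith
  linarith [nonneg_of_mul_nonneg_right this hpos]

lemma slope_le (h : IsRadialComponent n p δ u v U) (h' : IsRadialComponent n q μ v u V)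
    (hn : 2 ≤ n) (hp : 2 ≤ p) {r : ℝ} (hr : 0 < r) :
    r ^ (p - 1) * U r ^ (p - 1) ≤ 2 ^ (n - 1) * u r ^ (p - 1) := by
  have hr2 : r < 2 * r := by linarith
  obtain ⟨ξ, ⟨hξ1, hξ2⟩, hξ⟩ := exists_hasDerivAt_eq_slope u (fun s => -U s) hr2
    (fun s hs => (h.hasDerivAt s (hr.trans_le hs.1)).continuousAt.continuousWithinAt)
    (fun s hs => h.hasDerivAt s (hr.trans hs.1))
  have hξ0 : 0 < ξ := hr.trans hξ1
  have hUξ := h.slope_pos ξ hξ0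
  have hle : r * U ξ ≤ u r := by
    have := h.pos (2 * r) (by linarith)
    rw [eq_div_iff (by linarith)] at hξ
    linarith
  have hmono : r ^ (n - 1) * U r ^ (p - 1) ≤ ξ ^ (n - 1) * U ξ ^ (p - 1) := by
    refine monotoneOn_of_hasDerivWithinAt_nonneg (f := fun s => s ^ (n - 1) * U s ^ (p - 1))
      (f' := fun s => s ^ (n - 1) * v s ^ δ) (convex_Ioi 0)
      (fun x hx => (h.hasDerivAt_flux x hx).continuousAt.continuousWithinAt) ?_ ?_ hr hξ0 hξ1.le
    · intro x hx
      rw [interior_Ioi] at hx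
      exact (h.hasDerivAt_flux x hx).hasDerivWithinAt
    · intro x hx
      rw [interior_Ioi] at hx
      have := h'.pos x hx
      have : 0 < x := hx
      positivity
  have hξn : ξ ^ (n - 1) ≤ r ^ (n - 1) * 2 ^ (n - 1) := by
    rw [← Real.mul_rpow hr.le (by norm_num)]
    exact Real.rpow_le_rpow hξ0.le (by linarith) (by linarith)
  have hU : U r ^ (p - 1) ≤ 2 ^ (n - 1) * U ξ ^ (p - 1) := by
    have h2 : ξ ^ (n - 1) * U ξ ^ (p - 1) ≤ r ^ (n - 1) * 2 ^ (n - 1) * U ξ ^ (p - 1) := by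
      gcongr
    refine le_of_mul_le_mul_left (a := r ^ (n - 1)) ?_ (Real.rpow_pos_of_pos hr _)
    linarith
  calc r ^ (p - 1) * U r ^ (p - 1) ≤ r ^ (p - 1) * (2 ^ (n - 1) * U ξ ^ (p - 1)) := by gcongr
    _ = 2 ^ (n - 1) * (r * U ξ) ^ (p - 1) := by
      rw [Real.mul_rpow hr.le hUξ.le]
      ring
    _ ≤ 2 ^ (n - 1) * u r ^ (p - 1) := by
      gcongr
      linarith

lemma log_slope_le (h : IsRadialComponent n p δ u v U) (h' : IsRadialComponent n q μ v u V)
    (hn : 2 ≤ n) (hp : 2 ≤ p) {r : ℝ} (hr : 0 < r) :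
    (p - 1) * Real.log r + (p - 1) * Real.log (U r) ≤
      (n - 1) * Real.log 2 + (p - 1) * Real.log (u r) := by
  have hU := h.slope_pos r hr
  have hu := h.pos r hr
  have := Real.log_le_log (by positivity) (h.slope_le h' hn hp hr)
  rwa [Real.log_mul (by positivity) (by positivity), Real.log_mul (by positivity) (by positivity),
    Real.log_rpow hr, Real.log_rpow hU, Real.log_rpow hu, Real.log_rpow two_pos] at this

lemma log_le (h : IsRadialComponent n p δ u v U) (h' : IsRadialComponent n q μ v u V)
    (hn : 2 ≤ n) (hp : 2 ≤ p) (hδ : 0 < δ) {r : ℝ} (hr : 0 < r) :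
    p * Real.log r + δ * Real.log (v r) ≤
      (n - 1) * Real.log 2 + Real.log n + (p - 1) * Real.log (u r) := by
  have hU := h.slope_pos r hr
  have hv := h'.pos r hr
  have h1 := Real.log_le_log (by positivity) (h.mul_rpow_le_slope h' hn hp hδ hr)
  rw [Real.log_mul (by positivity) (by positivity), Real.log_mul (by positivity) (by positivity),
    Real.log_rpow hv, Real.log_rpow hU] at h1
  linarith [h.log_slope_le h' hn hp hr]

lemma mul_deriv_slope_rpow (h : IsRadialComponent n p δ u v U) {r : ℝ} (hr : 0 < r) :
    r * ((p - 1) * U r ^ (p - 2) * deriv U r) = r * v r ^ δ - (n - 1) * U r ^ (p - 1) := by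
  have h1 := ((h.differentiableAt r hr).hasDerivAt).rpow_const (p := p - 1)
    (Or.inl (h.slope_pos r hr).ne')
  have h2 := ((hasDerivAt_id r).rpow_const (p := n - 1) (Or.inl hr.ne')).mul h1
  have h3 := (h.hasDerivAt_flux r hr).unique h2
  have hrn : r ^ (n - 1) = r ^ (n - 1 - 1) * r := by
    rw [← Real.rpow_add_one hr.ne', sub_add_cancel]
  have hpos : 0 < r ^ (n - 1 - 1) := Real.rpow_pos_of_pos hr _
  simp only [id] at h3
  rw [hrn, show p - 1 - 1 = p - 2 by ring] at h3
  refine mul_left_cancel₀ hpos.ne' ?_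
  linear_combination -h3

end IsRadialComponent

/-- A lower bound, in the subcritical range, for the exponents `α`, `β` of the scaling-invariant
decay `u = O(r ^ (-α))`, `v = O(r ^ (-β))`. -/
lemma decay_exponents_gt {n p q δ μ : ℝ} (hn : 2 ≤ n) (hq : 2 ≤ q) (hqp : q ≤ p) (hδ : 0 < δ)
    (hμ : 0 < μ) (hsub : 1 - p / (p - 1) / n < 1 / (δ + 1) + 1 / (μ + 1)) {α β : ℝ}
    (hα : 0 < α) (hβ : 0 < β) (hX : (p - 1) * α + p = δ * β) (hY : (q - 1) * β + q = μ * α) :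
    n + p / (p - 1) < ((p - 1) * α + p) + ((q - 1) * β + q) := by
  by_contra! hle
  set X := (p - 1) * α + p with hXdef
  set Y := (q - 1) * β + q with hYdef
  have hXp : p < X := by
    have : 0 < (p - 1) * α := mul_pos (by linarith) hα
    linarith
  have hYq : q < Y := by
    have : 0 < (q - 1) * β := mul_pos (by linarith) hβ
    linarith
  have hαX : α ≤ X - p := by nlinarith
  have hβY : β ≤ Y - q := by nlinarith
  have hp1 : p / (p - 1) ≤ 2 := by
    rw [div_le_iff₀ (by linarith)]
    linarith
  have hp0 : 0 < p / (p - 1) := div_pos (by linarith) (by linarith)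
  have h1 : 1 / (δ + 1) ≤ 1 - X / (X + Y - q) := by
    have : 1 / (δ + 1) = β / (X + β) := by
      rw [div_eq_div_iff (by linarith) (by linarith), hX]
      ring
    rw [this, one_sub_div (by linarith), div_le_div_iff₀ (by linarith) (by linarith)]
    nlinarith
  have h2 : 1 / (μ + 1) ≤ 1 - Y / (X + Y - q) := by
    have : 1 / (μ + 1) = α / (Y + α) := by
      rw [div_eq_div_iff (by linarith) (by linarith), hY]
      ring
    rw [this, one_sub_div (by linarith), div_le_div_iff₀ (by linarith) (by linarith)]
    nlinarith
  have h3 : X / (X + Y - q) + Y / (X + Y - q) = 1 + q / (X + Y - q) := by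
    have : X + Y - q ≠ 0 := by linarith
    field_simp
    ring
  have h4 : p / (p - 1) / n ≤ q / (X + Y - q) := by
    rw [div_le_div_iff₀ (by linarith) (by linarith)]
    have h5 : p / (p - 1) * (X + Y - q) ≤ p / (p - 1) * n := by
      gcongr
      linarith
    nlinarith
  linarith

namespace IsRadialComponent

variable {n p q δ μ : ℝ} {u v U V : ℝ → ℝ}

lemma hasDerivAt_slope_rpow (h : IsRadialComponent n p δ u v U) {r : ℝ} (hr : 0 < r) :
    HasDerivAt (fun s => U s ^ (p - 1)) (v r ^ δ - (n - 1) * U r ^ (p - 1) / r) r := by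
  refine (((h.differentiableAt r hr).hasDerivAt).rpow_const (p := p - 1)
    (Or.inl (h.slope_pos r hr).ne')).congr_deriv ?_
  have := h.mul_deriv_slope_rpow hr
  rw [show p - 1 - 1 = p - 2 by ring]
  field_simp
  linarith

lemma hasDerivAt_slope_rpow_sub_two (h : IsRadialComponent n p δ u v U) (hp : 2 ≤ p) {r : ℝ}
    (hr : 0 < r) :
    HasDerivAt (fun s => U s ^ (p - 2))
      ((p - 2) / (p - 1) * (r * v r ^ δ - (n - 1) * U r ^ (p - 1)) / (r * U r)) r := by
  have hU := h.slope_pos r hr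
  refine (((h.differentiableAt r hr).hasDerivAt).rpow_const (p := p - 2)
    (Or.inl hU.ne')).congr_deriv ?_
  have hp1 : p - 1 ≠ 0 := by linarith
  rw [← h.mul_deriv_slope_rpow hr, show p - 2 = (p - 2 - 1) + 1 by ring,
    Real.rpow_add_one hU.ne', show p - 2 - 1 + 1 = p - 2 by ring]
  field_simp

/-- The part of the Pohozaev-type functional coming from one equation, and its derivative. -/
lemma exists_hasDerivAt_defect (h : IsRadialComponent n p δ u v U)
    (h' : IsRadialComponent n q μ v u V) (hq : 2 ≤ q) (m : ℝ) {r : ℝ} (hr : 0 < r) :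
    ∃ B, HasDerivAt (fun s => s ^ (m - 1) *
        (v s * (V s ^ (q - 2) * (n * U s ^ (p - 1) - s * v s ^ δ)))) B r ∧
      r * B = r ^ (m - 1) *
        ((m - n + (q - 2) / (q - 1)) * (v r * V r ^ (q - 2) * (n * U r ^ (p - 1) - r * v r ^ δ))
        - (q - 2) / (q - 1) * (v r / V r) * (n * U r ^ (p - 1) - r * v r ^ δ) *
          (n * V r ^ (q - 1) - r * u r ^ μ)
        - r * V r ^ (q - 1) * (n * U r ^ (p - 1) - r * v r ^ δ)
        + δ * r ^ 2 * v r ^ δ * V r ^ (q - 1)) := by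
  have hv := h'.pos r hr
  have hV := h'.slope_pos r hr
  have hq1 : q - 1 ≠ 0 := by linarith
  have hdv := h'.hasDerivAt r hr
  have hdZ := ((h.hasDerivAt_slope_rpow hr).const_mul n).sub
    ((hasDerivAt_id r).mul (hdv.rpow_const (p := δ) (Or.inl hv.ne')))
  refine ⟨_, ((hasDerivAt_id r).rpow_const (p := m - 1) (Or.inl hr.ne')).mul
    (hdv.mul ((h'.hasDerivAt_slope_rpow_sub_two hq hr).mul hdZ)), ?_⟩
  simp only [id]
  have e1 : r ^ (m - 1) = r ^ (m - 1 - 1) * r := by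
    rw [← Real.rpow_add_one hr.ne', sub_add_cancel]
  have e2 : V r ^ (q - 1) = V r ^ (q - 2) * V r := by
    rw [← Real.rpow_add_one hV.ne', show q - 2 + 1 = q - 1 by ring]
  have e3 : v r ^ δ = v r ^ (δ - 1) * v r := by
    rw [← Real.rpow_add_one hv.ne', sub_add_cancel]
  rw [e1, e2, e3]
  field_simp
  ring

end IsRadialComponent

/-- A Pohozaev-type functional of the radial system. -/
noncomputable def radialPohozaev (n p q δ μ : ℝ) (u v U V : ℝ → ℝ) (r : ℝ) : ℝ :=
  let m := n - 2 + p / (p - 1)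
  r ^ m * (U r ^ (p - 1) * V r ^ (q - 1))
    - 1 / (δ + 1) * (r ^ (m - 1) *
      (v r * (V r ^ (q - 2) * (n * U r ^ (p - 1) - r * v r ^ δ))))
    - 1 / (μ + 1) * (r ^ (m - 1) *
      (u r * (U r ^ (p - 2) * (n * V r ^ (q - 1) - r * u r ^ μ))))

section Pohozaev

variable {n p q δ μ : ℝ} {u v U V : ℝ → ℝ}

lemma exists_hasDerivAt_radialPohozaev (h : IsRadialComponent n p δ u v U)
    (h' : IsRadialComponent n q μ v u V) (hn : 2 ≤ n) (hq : 2 ≤ q) (hqp : q ≤ p)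
    (hδ : 0 < δ) (hμ : 0 < μ) (hsub : 1 - p / (p - 1) / n < 1 / (δ + 1) + 1 / (μ + 1))
    {r : ℝ} (hr : 0 < r) :
    ∃ B, HasDerivAt (radialPohozaev n p q δ μ u v U V) B r ∧ 0 < B := by
  have hp : 2 ≤ p := hq.trans hqp
  have hu := h.pos r hr
  have hv := h'.pos r hr
  have hU := h.slope_pos r hr
  have hV := h'.slope_pos r hr
  have hp1 : p - 1 ≠ 0 := by linarith
  have hq1 : q - 1 ≠ 0 := by linarith
  set m := n - 2 + p / (p - 1) with hm
  obtain ⟨B₁, hB₁, hB₁'⟩ := h.exists_hasDerivAt_defect h' hq m hr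
  obtain ⟨B₂, hB₂, hB₂'⟩ := h'.exists_hasDerivAt_defect h hp m hr
  have hZ := h.mul_rpow_le_slope h' hn hp hδ hr
  have hY := h'.mul_rpow_le_slope h hn hq hμ hr
  refine ⟨_, ((((hasDerivAt_id r).rpow_const (p := m) (Or.inl hr.ne')).mul
    ((h.hasDerivAt_slope_rpow hr).mul (h'.hasDerivAt_slope_rpow hr))).sub
    (hB₁.const_mul (1 / (δ + 1)))).sub (hB₂.const_mul (1 / (μ + 1))), ?_⟩
  refine pos_of_mul_pos_right (a := r) ?_ hr.le
  simp only [id, Pi.mul_apply]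
  have hmp : m - n + (p - 2) / (p - 1) = 0 := by
    rw [hm]; field_simp; ring
  have hmq : m - n + (q - 2) / (q - 1) = p / (p - 1) - q / (q - 1) := by
    rw [hm]; field_simp; ring
  have hpq : p / (p - 1) ≤ q / (q - 1) := by
    rw [div_le_div_iff₀ (by linarith) (by linarith)]
    linarith
  rw [hmq] at hB₁'
  rw [hmp] at hB₂'
  have hρ : 0 < r ^ (m - 1) := Real.rpow_pos_of_pos hr _
  have hrm : r ^ m = r ^ (m - 1) * r := by
    rw [← Real.rpow_add_one hr.ne', sub_add_cancel]
  have hC : 0 < n * (1 / (δ + 1) + 1 / (μ + 1)) - n + p / (p - 1) := by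
    have hn0 : 0 < n := by linarith
    have := mul_lt_mul_of_pos_left hsub hn0
    have e : n * (1 - p / (p - 1) / n) = n - p / (p - 1) := by field_simp
    linarith
  have ea := Real.rpow_pos_of_pos hU (p - 1)
  have eb := Real.rpow_pos_of_pos hV (q - 1)
  have ee := Real.rpow_pos_of_pos hU (p - 2)
  have ef := Real.rpow_pos_of_pos hV (q - 2)
  generalize U r ^ (p - 1) = a at *
  generalize V r ^ (q - 1) = b at *
  generalize U r ^ (p - 2) = e at *
  generalize V r ^ (q - 2) = f at *
  generalize v r ^ δ = g at *
  generalize u r ^ μ = k at *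
  have key : r * (1 * m * r ^ (m - 1) * (a * b) + r ^ m *
      ((g - (n - 1) * a / r) * b + a * (k - (n - 1) * b / r)) - 1 / (δ + 1) * B₁
        - 1 / (μ + 1) * B₂) =
      r ^ (m - 1) * ((n * (1 / (δ + 1) + 1 / (μ + 1)) - n + p / (p - 1)) * r * a * b
        + 1 / (δ + 1) * ((q / (q - 1) - p / (p - 1)) * (v r * f * (n * a - r * g))
          + (q - 2) / (q - 1) * (v r / V r) * (n * a - r * g) * (n * b - r * k))
        + 1 / (μ + 1) * ((p - 2) / (p - 1) * (u r / U r) * (n * b - r * k) * (n * a - r * g))) := by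
    have hδ1 : 1 / (δ + 1) * δ = 1 - 1 / (δ + 1) := by field_simp; ring
    have hμ1 : 1 / (μ + 1) * μ = 1 - 1 / (μ + 1) := by field_simp; ring
    generalize 1 / (δ + 1) = κ at *
    generalize 1 / (μ + 1) = ν at *
    have e1 : r * ((g - (n - 1) * a / r) * b + a * (k - (n - 1) * b / r)) =
        (r * g - (n - 1) * a) * b + a * (r * k - (n - 1) * b) := by field_simp
    rw [hrm]
    generalize r ^ (m - 1) = ρ at *
    linear_combination -κ * hB₁' - ν * hB₂' + ρ * r * e1 - ρ * r ^ 2 * g * b * hδ1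
      - ρ * r ^ 2 * k * a * hμ1 + ρ * r * a * b * hm
  refine lt_of_lt_of_eq ?_ key.symm
  have hZ0 := sub_nonneg.2 hZ
  have hY0 := sub_nonneg.2 hY
  have hpq0 := sub_nonneg.2 hpq
  have hp2 := sub_nonneg.2 hp
  have hq2 := sub_nonneg.2 hq
  have hp1' : 0 < p - 1 := by linarith
  have hq1' : 0 < q - 1 := by linarith
  positivity

lemma tendsto_radialPohozaev (h : IsRadialComponent n p δ u v U)
    (h' : IsRadialComponent n q μ v u V) (hn : 2 ≤ n) (hp : 2 ≤ p) (hq : 2 ≤ q)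
    (hδ : 0 < δ) (hμ : 0 < μ) :
    Tendsto (radialPohozaev n p q δ μ u v U V) (𝓝[>] 0) (𝓝 0) := by
  have hm : 1 < n - 2 + p / (p - 1) := by
    have : 1 < p / (p - 1) := by
      rw [lt_div_iff₀ (by linarith)]
      linarith
    linarith
  unfold radialPohozaev
  set m := n - 2 + p / (p - 1)
  have hid : Tendsto (fun s : ℝ => s) (𝓝[>] 0) (𝓝 0) :=
    tendsto_nhdsWithin_of_tendsto_nhds tendsto_id
  obtain ⟨a, _, ha⟩ := h.tendsto
  obtain ⟨b, _, hb⟩ := h'.tendsto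
  obtain ⟨c, hc⟩ := h.tendsto_slope
  obtain ⟨d, hd⟩ := h'.tendsto_slope
  have hrm := hid.rpow_const (p := m) (Or.inr (by linarith))
  have hrm1 := hid.rpow_const (p := m - 1) (Or.inr (by linarith))
  rw [Real.zero_rpow (by linarith)] at hrm hrm1
  have hc1 := hc.rpow_const (p := p - 1) (Or.inr (by linarith))
  have hc2 := hc.rpow_const (p := p - 2) (Or.inr (by linarith))
  have hd1 := hd.rpow_const (p := q - 1) (Or.inr (by linarith))
  have hd2 := hd.rpow_const (p := q - 2) (Or.inr (by linarith))
  have hbδ := hb.rpow_const (p := δ) (Or.inr hδ.le)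
  have haμ := ha.rpow_const (p := μ) (Or.inr hμ.le)
  have := ((hrm.mul (hc1.mul hd1)).sub ((hrm1.mul (hb.mul (hd2.mul
    ((hc1.const_mul n).sub (hid.mul hbδ))))).const_mul (1 / (δ + 1)))).sub
    ((hrm1.mul (ha.mul (hc2.mul
    ((hd1.const_mul n).sub (hid.mul haμ))))).const_mul (1 / (μ + 1)))
  simpa using this

lemma radialPohozaev_le (h : IsRadialComponent n p δ u v U)
    (h' : IsRadialComponent n q μ v u V) (hn : 2 ≤ n) (hp : 2 ≤ p) (hq : 2 ≤ q)
    (hδ : 0 < δ) (hμ : 0 < μ) {r : ℝ} (hr : 0 < r) :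
    radialPohozaev n p q δ μ u v U V r ≤
      r ^ (n - 2 + p / (p - 1)) * (U r ^ (p - 1) * V r ^ (q - 1)) := by
  have hu := h.pos r hr
  have hv := h'.pos r hr
  have hU := h.slope_pos r hr
  have hV := h'.slope_pos r hr
  have hZ := sub_nonneg.2 (h.mul_rpow_le_slope h' hn hp hδ hr)
  have hY := sub_nonneg.2 (h'.mul_rpow_le_slope h hn hq hμ hr)
  unfold radialPohozaev
  rw [sub_sub]
  refine sub_le_self _ ?_
  positivity

/-- The radial system has no positive decreasing solution on `(0,∞)` in the subcritical range. -/
lemma not_isRadialComponent_of_subcritical (hn : 2 ≤ n) (hq : 2 ≤ q) (hqp : q ≤ p)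
    (hδ : 0 < δ) (hμ : 0 < μ) (hD : 0 < δ * μ - (p - 1) * (q - 1))
    (hsub : 1 - p / (p - 1) / n < 1 / (δ + 1) + 1 / (μ + 1))
    (h : IsRadialComponent n p δ u v U) (h' : IsRadialComponent n q μ v u V) : False := by
  have hp : 2 ≤ p := hq.trans hqp
  choose! B hB hBpos using fun r (hr : 0 < r) =>
    exists_hasDerivAt_radialPohozaev h h' hn hq hqp hδ hμ hsub hr
  obtain ⟨hGpos, hGmono⟩ := pos_and_strictMonoOn_of_hasDerivAt_of_tendsto_zero hB hBpos
    (tendsto_radialPohozaev h h' hn hp hq hδ hμ)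
  set D := δ * μ - (p - 1) * (q - 1) with hDdef
  set α := (p * (q - 1) + q * δ) / D with hα
  set β := (q * (p - 1) + p * μ) / D with hβ
  have hp1 : 0 < p - 1 := by linarith
  have hq1 : 0 < q - 1 := by linarith
  have hDα : D * α = p * (q - 1) + q * δ := by rw [hα]; field_simp
  have hDβ : D * β = q * (p - 1) + p * μ := by rw [hβ]; field_simp
  have hα0 : 0 < α := by positivity
  have hβ0 : 0 < β := by positivity
  have hX : (p - 1) * α + p = δ * β := by
    refine mul_left_cancel₀ hD.ne' ?_
    linear_combination (p - 1) * hDα - δ * hDβ + p * hDdef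
  have hY : (q - 1) * β + q = μ * α := by
    refine mul_left_cancel₀ hD.ne' ?_
    linear_combination (q - 1) * hDβ - μ * hDα + q * hDdef
  have hgap := decay_exponents_gt hn hq hqp hδ hμ hsub hα0 hβ0 hX hY
  set K := (n - 1) * Real.log 2 + Real.log n with hK
  have hbound : ∀ r, 1 ≤ r →
      Real.log (radialPohozaev n p q δ μ u v U V 1) ≤
        2 * (n - 1) * Real.log 2 + (p - 1) * ((q - 1 + δ) * K / D)
          + (q - 1) * ((p - 1 + μ) * K / D)
          - (((p - 1) * α + p) + ((q - 1) * β + q) - (n + p / (p - 1))) * Real.log r := by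
    intro r hr1
    have hr : 0 < r := by linarith
    have hU := h.slope_pos r hr
    have hV := h'.slope_pos r hr
    have h1 : radialPohozaev n p q δ μ u v U V 1 ≤
        r ^ (n - 2 + p / (p - 1)) * (U r ^ (p - 1) * V r ^ (q - 1)) :=
      (hGmono.monotoneOn (mem_Ioi.2 one_pos) hr hr1).trans
        (radialPohozaev_le h h' hn hp hq hδ hμ hr)
    have h2 := Real.log_le_log (hGpos 1 one_pos) h1
    rw [Real.log_mul (by positivity) (by positivity), Real.log_mul (by positivity) (by positivity),
      Real.log_rpow hr, Real.log_rpow hU, Real.log_rpow hV] at h2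
    have l1 := h.log_le h' hn hp hδ hr
    have l2 := h'.log_le h hn hq hμ hr
    have s1 := h.log_slope_le h' hn hp hr
    have s2 := h'.log_slope_le h hn hq hr
    have hlu : Real.log (u r) ≤ (q - 1 + δ) * K / D - α * Real.log r := by
      rw [hα, div_mul_eq_mul_div, ← sub_div, le_div_iff₀ hD]
      have e1 := mul_le_mul_of_nonneg_left l1 hq1.le
      have e2 := mul_le_mul_of_nonneg_left l2 hδ.le
      rw [hDdef]
      linarith
    have hlv : Real.log (v r) ≤ (p - 1 + μ) * K / D - β * Real.log r := by
      rw [hβ, div_mul_eq_mul_div, ← sub_div, le_div_iff₀ hD]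
      have e1 := mul_le_mul_of_nonneg_left l2 hp1.le
      have e2 := mul_le_mul_of_nonneg_left l1 hμ.le
      rw [hDdef]
      linarith
    have e1 := mul_le_mul_of_nonneg_left hlu hp1.le
    have e2 := mul_le_mul_of_nonneg_left hlv hq1.le
    linarith
  have htend : Tendsto (fun r => (((p - 1) * α + p) + ((q - 1) * β + q) - (n + p / (p - 1))) *
      Real.log r) atTop atTop :=
    Real.tendsto_log_atTop.const_mul_atTop (by linarith)
  obtain ⟨r, hr, hr1⟩ := ((htend.eventually_gt_atTop
    (2 * (n - 1) * Real.log 2 + (p - 1) * ((q - 1 + δ) * K / D)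
      + (q - 1) * ((p - 1 + μ) * K / D)
      - Real.log (radialPohozaev n p q δ μ u v U V 1))).and (eventually_ge_atTop 1)).exists
  linarith [hbound r hr1]

end Pohozaev

/-- Nonexistence of radial ground states of (S_∞) in the superquadratic case. -/
theorem no_groundstate_superquadratic (N : ℕ) (hN : 2 ≤ N) (p q δ μ : ℝ)
    (hδ : 0 < δ) (hμ : 0 < μ) (hH1 : 0 < δ * μ - (p - 1) * (q - 1))
    (hp1 : 2 ≤ p) (hp2 : p < (N : ℝ)) (hq1 : 2 ≤ q) (hq2 : q < (N : ℝ))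
    (hineq : 1 / (δ + 1) + 1 / (μ + 1) >
      ((N : ℝ) * (max p q - 1) - max p q) / (N * (max p q - 1))) :
    ¬ ∃ u v : ℝ → ℝ, IsGroundState N p q δ μ u v := by
  rintro ⟨u, v, hu1, hv1, hu2, hv2, hu, hv, -, -, hequ, heqv⟩
  have hn : (2 : ℝ) ≤ N := by exact_mod_cast hN
  have h := isRadialComponent_of_contDiffOn hn hp1 hu1 hu2 hu hv hequ
  have h' := isRadialComponent_of_contDiffOn hn hq1 hv1 hv2 hv hu heqv
  have hM : max p q - 1 ≠ 0 := by linarith [le_max_left p q]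
  have hn0 : (N : ℝ) ≠ 0 := by linarith
  have hrw : ((N : ℝ) * (max p q - 1) - max p q) / (N * (max p q - 1)) =
      1 - max p q / (max p q - 1) / N := by
    field_simp
  rw [hrw] at hineq
  rcases le_total q p with hqp | hpq
  · rw [max_eq_left hqp] at hineq
    exact not_isRadialComponent_of_subcritical hn hq1 hqp hδ hμ hH1 hineq h h'
  · rw [max_eq_right hpq] at hineq
    refine not_isRadialComponent_of_subcritical hn hp1 hpq hμ hδ ?_ ?_ h' h
    · linarith
    · linarith
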